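/- arXiv:2009.02694 — 2 statements merged into one kernel-verified Lean document; each statement's English description precedes it below -/
import Mathlib

section
/- End-to-end channel (Theorem 1). Suppose the voltage and current vectors V_T, I_T ∈ ℂ^{N_t}, V_S, I_S ∈ ℂ^{N_ris}, V_L, I_L ∈ ℂ^{N_r} satisfy the impedance system V_T = Z_TT I_T + Z_TS I_S + Z_TR I_L, V_S = Z_ST I_T + Z_SS I_S + Z_SR I_L, V_L = Z_RT I_T + Z_RS I_S + Z_RR I_L, together with the port relations V_T = V_G − Z_G I_T, V_S = −Z_RIS I_S, V_L = −Z_L I_L for a given generator voltage vector V_G ∈ ℂ^{N_t}. Assume Z_RIS + Z_SS, Z_L, P_GTST := Z_G + P_TST, and M := 1 + P_RSR · Z_L⁻¹ − P_RST · P_GTST⁻¹ · P_TSR · Z_L⁻¹ are all invertible. Then V_L = H_E2E · V_G, where H_E2E := M⁻¹ · P_RST · P_GTST⁻¹. -/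
open Matrix

/-- An invertible linear system has the solution given by the inverse matrix. -/
theorem Matrix.eq_inv_mulVec_of_mulVec_eq {n R : Type*} [Fintype n] [DecidableEq n] [CommRing R]
    {A : Matrix n n R} (hA : IsUnit A) {x y : n → R} (h : A *ᵥ x = y) : x = A⁻¹ *ᵥ y := by
  rw [← h, mulVec_mulVec, nonsing_inv_mul A ((isUnit_iff_isUnit_det A).mp hA), one_mulVec]

/-- Substituting the middle variable `-(W *ᵥ (C *ᵥ x + D *ᵥ y))` in a row of a block linear
system yields Schur-complement coefficients. -/
theorem Matrix.mulVec_add_mulVec_neg_add_mulVec {k l m n R : Type*} [Fintype l] [Fintype m]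
    [Fintype n] [CommRing R] (A : Matrix k l R) (B : Matrix k m R) (E : Matrix k n R)
    (W : Matrix m m R) (C : Matrix m l R) (D : Matrix m n R) (x : l → R) (y : n → R) :
    A *ᵥ x + B *ᵥ (-(W *ᵥ (C *ᵥ x + D *ᵥ y))) + E *ᵥ y =
      (A - B * W * C) *ᵥ x + (E - B * W * D) *ᵥ y := by
  simp only [mulVec_neg, mulVec_add, sub_mulVec, mulVec_mulVec, Matrix.mul_assoc]
  abel

/-- **End-to-end channel (Theorem 1).** If the port voltages/currents of the transmitter,
RIS, and receiver satisfy the mutual-impedance system together with the generator and load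
port relations, and the indicated matrices are invertible, then the load voltage vector is
obtained from the generator voltage vector through the end-to-end channel matrix
`H_E2E = M⁻¹ * P_RST * P_GTST⁻¹`. -/
theorem end_to_end_channel
    {Nt Nris Nr : ℕ} (hNt : 0 < Nt) (hNris : 0 < Nris) (hNr : 0 < Nr)
    (Z_TT : Matrix (Fin Nt) (Fin Nt) ℂ) (Z_TS : Matrix (Fin Nt) (Fin Nris) ℂ)
    (Z_TR : Matrix (Fin Nt) (Fin Nr) ℂ) (Z_ST : Matrix (Fin Nris) (Fin Nt) ℂ)
    (Z_SS : Matrix (Fin Nris) (Fin Nris) ℂ) (Z_SR : Matrix (Fin Nris) (Fin Nr) ℂ)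
    (Z_RT : Matrix (Fin Nr) (Fin Nt) ℂ) (Z_RS : Matrix (Fin Nr) (Fin Nris) ℂ)
    (Z_RR : Matrix (Fin Nr) (Fin Nr) ℂ)
    (Z_G : Matrix (Fin Nt) (Fin Nt) ℂ) (Z_RIS : Matrix (Fin Nris) (Fin Nris) ℂ)
    (Z_L : Matrix (Fin Nr) (Fin Nr) ℂ)
    (V_T I_T V_G : Fin Nt → ℂ) (V_S I_S : Fin Nris → ℂ) (V_L I_L : Fin Nr → ℂ)
    -- the impedance system V = Z I
    (hVT : V_T = Z_TT.mulVec I_T + Z_TS.mulVec I_S + Z_TR.mulVec I_L)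
    (hVS : V_S = Z_ST.mulVec I_T + Z_SS.mulVec I_S + Z_SR.mulVec I_L)
    (hVL : V_L = Z_RT.mulVec I_T + Z_RS.mulVec I_S + Z_RR.mulVec I_L)
    -- the port relations
    (hG : V_T = V_G - Z_G.mulVec I_T)
    (hS : V_S = -(Z_RIS.mulVec I_S))
    (hL : V_L = -(Z_L.mulVec I_L))
    -- the reduced matrices P_XSY = Z_XY - Z_XS (Z_RIS + Z_SS)⁻¹ Z_SY
    (P_TST : Matrix (Fin Nt) (Fin Nt) ℂ) (P_TSR : Matrix (Fin Nt) (Fin Nr) ℂ)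
    (P_RST : Matrix (Fin Nr) (Fin Nt) ℂ) (P_RSR : Matrix (Fin Nr) (Fin Nr) ℂ)
    (hPTST : P_TST = Z_TT - Z_TS * (Z_RIS + Z_SS)⁻¹ * Z_ST)
    (hPTSR : P_TSR = Z_TR - Z_TS * (Z_RIS + Z_SS)⁻¹ * Z_SR)
    (hPRST : P_RST = Z_RT - Z_RS * (Z_RIS + Z_SS)⁻¹ * Z_ST)
    (hPRSR : P_RSR = Z_RR - Z_RS * (Z_RIS + Z_SS)⁻¹ * Z_SR)
    -- invertibility assumptions
    (hinvS : IsUnit (Z_RIS + Z_SS))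
    (hinvL : IsUnit Z_L)
    (hinvG : IsUnit (Z_G + P_TST))
    (hinvM : IsUnit
      (1 + P_RSR * Z_L⁻¹ - P_RST * (Z_G + P_TST)⁻¹ * P_TSR * Z_L⁻¹)) :
    V_L = ((1 + P_RSR * Z_L⁻¹ - P_RST * (Z_G + P_TST)⁻¹ * P_TSR * Z_L⁻¹)⁻¹ *
      (P_RST * (Z_G + P_TST)⁻¹)).mulVec V_G := by
  have hIS : I_S = -((Z_RIS + Z_SS)⁻¹ *ᵥ (Z_ST *ᵥ I_T + Z_SR *ᵥ I_L)) := by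
    rw [← mulVec_neg]
    apply eq_inv_mulVec_of_mulVec_eq hinvS
    rw [add_mulVec, ← neg_eq_iff_eq_neg.mpr hS, hVS]
    abel
  have hIL : I_L = -(Z_L⁻¹ *ᵥ V_L) := by
    rw [← mulVec_neg]
    exact eq_inv_mulVec_of_mulVec_eq hinvL (by rw [hL, neg_neg])
  rw [hIS, mulVec_add_mulVec_neg_add_mulVec, ← hPTST, ← hPTSR] at hVT
  rw [hIS, mulVec_add_mulVec_neg_add_mulVec, ← hPRST, ← hPRSR] at hVL
  have hIT : I_T = (Z_G + P_TST)⁻¹ *ᵥ (V_G - P_TSR *ᵥ I_L) := by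
    apply eq_inv_mulVec_of_mulVec_eq hinvG
    rw [add_mulVec, eq_sub_iff_add_eq, add_assoc, ← hVT, hG]
    abel
  rw [← mulVec_mulVec]
  apply eq_inv_mulVec_of_mulVec_eq hinvM
  rw [hIT, hIL] at hVL
  simp only [mulVec_neg, mulVec_mulVec, sub_neg_eq_add, mulVec_add] at hVL
  simp only [sub_mulVec, add_mulVec, one_mulVec, Matrix.mul_assoc]
  nth_rewrite 1 [hVL]
  abel
end

section
/- Exact algebraic form of Corollary 1 (single-antenna transmitter and receiver). Let N_t = N_r = 1, so that Z_TT, Z_RR, Z_RT, Z_TR, Z_G, Z_L, V_G, V_T, V_L, I_T, I_L are complex scalars, Z_TS and Z_RS are 1×N_ris row vectors, Z_ST and Z_SR are N_ris×1 column vectors, and set Φ := (Z_RIS + Z_SS)⁻¹. Suppose the impedance system V_T = Z_TT I_T + Z_TS I_S + Z_TR I_L, V_S = Z_ST I_T + Z_SS I_S + Z_SR I_L, V_L = Z_RT I_T + Z_RS I_S + Z_RR I_L and the port relations V_T = V_G − Z_G I_T, V_S = −Z_RIS I_S, V_L = −Z_L I_L hold, that Z_RIS + Z_SS is invertible, and that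 (i) Z_TS Φ Z_ST = 0, (ii) Z_RS Φ Z_SR = 0, (iii) Z_TR − Z_TS Φ Z_SR = 0, with Z_L ≠ 0, Z_L + Z_RR ≠ 0, and Z_G + Z_TT ≠ 0. Then V_L = 𝒴₀ · (Z_RT − Z_RS Φ Z_ST) · V_G, where 𝒴₀ := Z_L / ((Z_L + Z_RR) · (Z_G + Z_TT)). -/
open Matrix

/-- Eliminating the scatterer currents from the loaded scatterer equations. -/
theorem scatterer_current_eq {n K : Type*} [Fintype n] [DecidableEq n] [CommRing K]
    {A B : Matrix n n K} (hAB : IsUnit (A + B)) {x u v : n → K} {a b : K}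
    (h : a • u + B *ᵥ x + b • v = -(A *ᵥ x)) :
    x = -(a • ((A + B)⁻¹ *ᵥ u) + b • ((A + B)⁻¹ *ᵥ v)) := by
  have hx : (A + B) *ᵥ x = -(a • u + b • v) := by
    rw [add_mulVec, eq_neg_iff_add_eq_zero, eq_comm, ← sub_eq_zero.mpr h]
    abel
  have hdet : IsUnit (A + B).det := (isUnit_iff_isUnit_det _).mp hAB
  rw [← mulVec_smul, ← mulVec_smul, ← mulVec_add, ← mulVec_neg, ← hx, mulVec_mulVec,
    nonsing_inv_mul _ hdet, one_mulVec]

/-- **Exact algebraic form of Corollary 1** (single-antenna transmitter and receiver).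
With `N_t = N_r = 1`, `Φ = (Z_RIS + Z_SS)⁻¹`, and the cross terms
`Z_TS Φ Z_ST`, `Z_RS Φ Z_SR`, `Z_TR - Z_TS Φ Z_SR` vanishing, the impedance system
and the port relations give `V_L = 𝒴₀ (Z_RT - Z_RS Φ Z_ST) V_G` with
`𝒴₀ = Z_L / ((Z_L + Z_RR)(Z_G + Z_TT))`. -/
theorem corollary_single_antenna
    {Nris : ℕ} (hNris : 0 < Nris)
    (Z_TT Z_RR Z_RT Z_TR Z_G Z_L : ℂ)
    (z_TS z_RS : Fin Nris → ℂ)  -- 1 × N_ris row vectors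
    (z_ST z_SR : Fin Nris → ℂ)  -- N_ris × 1 column vectors
    (Z_SS Z_RIS : Matrix (Fin Nris) (Fin Nris) ℂ)
    (V_T V_L V_G I_T I_L : ℂ) (V_S I_S : Fin Nris → ℂ)
    -- the impedance system
    (hVT : V_T = Z_TT * I_T + z_TS ⬝ᵥ I_S + Z_TR * I_L)
    (hVS : V_S = I_T • z_ST + Z_SS.mulVec I_S + I_L • z_SR)
    (hVL : V_L = Z_RT * I_T + z_RS ⬝ᵥ I_S + Z_RR * I_L)
    -- the port relations
    (hG : V_T = V_G - Z_G * I_T)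
    (hS : V_S = -(Z_RIS.mulVec I_S))
    (hL : V_L = -(Z_L * I_L))
    (hinvS : IsUnit (Z_RIS + Z_SS))
    -- vanishing cross terms, with Φ = (Z_RIS + Z_SS)⁻¹
    (h1 : z_TS ⬝ᵥ (Z_RIS + Z_SS)⁻¹.mulVec z_ST = 0)
    (h2 : z_RS ⬝ᵥ (Z_RIS + Z_SS)⁻¹.mulVec z_SR = 0)
    (h3 : Z_TR - z_TS ⬝ᵥ (Z_RIS + Z_SS)⁻¹.mulVec z_SR = 0)
    (hZL : Z_L ≠ 0) (hZLR : Z_L + Z_RR ≠ 0) (hZGT : Z_G + Z_TT ≠ 0) :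
    V_L = (Z_L / ((Z_L + Z_RR) * (Z_G + Z_TT))) *
      (Z_RT - z_RS ⬝ᵥ (Z_RIS + Z_SS)⁻¹.mulVec z_ST) * V_G := by
  have hIS := scatterer_current_eq hinvS (hVS.symm.trans hS)
  have hdot : ∀ w : Fin Nris → ℂ, w ⬝ᵥ I_S =
      -(I_T * (w ⬝ᵥ (Z_RIS + Z_SS)⁻¹.mulVec z_ST) +
        I_L * (w ⬝ᵥ (Z_RIS + Z_SS)⁻¹.mulVec z_SR)) := fun w => by
    conv_lhs => rw [hIS]
    simp only [dotProduct_neg, dotProduct_add, dotProduct_smul, smul_eq_mul]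
  rw [hdot, h1] at hVT
  rw [hdot, h2] at hVL
  have hVG : V_G = (Z_G + Z_TT) * I_T := by
    linear_combination hVT - hG + I_L * h3
  have hIL : (Z_L + Z_RR) * I_L =
      -((Z_RT - z_RS ⬝ᵥ (Z_RIS + Z_SS)⁻¹.mulVec z_ST) * I_T) := by
    linear_combination hL - hVL
  rw [hVG, hL]
  field_simp
  linear_combination -hIL
end
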